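/- arXiv:2602.21448 — 2 statements merged into one kernel-verified Lean document; each statement's English description precedes it below -/
import Mathlib

section
/- Let Y : Ω → ℝ be square-integrable with respect to the product probability measure μ. Then the variance of Y decomposes as Var_μ(Y) = Σ_{∅ ≠ I ⊆ N} σ²_I(Y), where σ²_I(Y) = ∫_Ω (P_I Y)² dμ; equivalently, with the convention σ²_∅(Y) = 0, one has σ²(Y) = Σ_{I ⊆ N} σ²_I(Y). -/
open MeasureTheory

/-- The marginal `A_J Y`: integrate out the coordinates not in `J`,
i.e. `(A_J Y)(x) = ∫ Y(z) dμ_{N∖J}(z)` with `z_i = x_i` for `i ∈ J`. -/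
noncomputable def margA {M : ℕ} {Ω : Fin M → Type*} [∀ i, MeasurableSpace (Ω i)]
    (μ : ∀ i, Measure (Ω i)) (J : Finset (Fin M)) (Y : (∀ i, Ω i) → ℝ) :
    (∀ i, Ω i) → ℝ :=
  fun x => ∫ z, Y (fun i => if i ∈ J then x i else z i) ∂(Measure.pi μ)

/-- The ANOVA projection `P_I Y`, defined recursively by
`P_I Y = A_I Y - ∑_{J ⊊ I} P_J Y` (so that `P_∅ Y = 𝔼_μ[Y]`). -/
noncomputable def anovaP {M : ℕ} {Ω : Fin M → Type*} [∀ i, MeasurableSpace (Ω i)]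
    (μ : ∀ i, Measure (Ω i)) (Y : (∀ i, Ω i) → ℝ) (I : Finset (Fin M)) :
    (∀ i, Ω i) → ℝ :=
  margA μ I Y - ∑ J ∈ I.ssubsets.attach, anovaP μ Y J.1
termination_by I.card
decreasing_by exact Finset.card_lt_card (Finset.mem_ssubsets.mp J.2)
open ProbabilityTheory

section AnovaHelpers

variable {M : ℕ} {Ω : Fin M → Type*} [∀ i, MeasurableSpace (Ω i)]

lemma mp_pi_prod {α β : Fin M → Type*} [∀ i, MeasurableSpace (α i)] [∀ i, MeasurableSpace (β i)]
    (μ : ∀ i, Measure (α i)) (ν : ∀ i, Measure (β i))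
    [∀ i, IsProbabilityMeasure (μ i)] [∀ i, IsProbabilityMeasure (ν i)] :
    MeasurePreserving (fun a : (∀ i, α i × β i) => ((fun i => (a i).1), (fun i => (a i).2)))
      (Measure.pi (fun i => (μ i).prod (ν i))) ((Measure.pi μ).prod (Measure.pi ν)) where
  measurable := by fun_prop
  map_eq := by
    refine (Measure.prod_eq_generateFrom generateFrom_pi generateFrom_pi isPiSystem_pi
      isPiSystem_pi (Measure.FiniteSpanningSetsIn.pi fun i => (μ i).toFiniteSpanningSetsIn)
      (Measure.FiniteSpanningSetsIn.pi fun i => (ν i).toFiniteSpanningSetsIn) ?_).symm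
    rintro _ ⟨s, hs, rfl⟩ _ ⟨t, ht, rfl⟩
    have hs' : ∀ i, MeasurableSet (s i) := fun i => hs i (Set.mem_univ i)
    have ht' : ∀ i, MeasurableSet (t i) := fun i => ht i (Set.mem_univ i)
    rw [Measure.map_apply (by fun_prop)
      ((MeasurableSet.univ_pi hs').prod (MeasurableSet.univ_pi ht'))]
    have : (fun a : (∀ i, α i × β i) => ((fun i => (a i).1), (fun i => (a i).2))) ⁻¹'
        (Set.univ.pi s ×ˢ Set.univ.pi t) = Set.univ.pi (fun i => s i ×ˢ t i) := by
      ext a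
      simp [Set.mem_pi, forall_and]
    rw [this]
    simp [Measure.pi_pi, Measure.prod_prod, Finset.prod_mul_distrib]

/-- Glue the coordinates of `x` in `J` and those of `z` outside `J`. -/
def glue (J : Finset (Fin M)) (x z : ∀ i, Ω i) : ∀ i, Ω i :=
  fun i => if i ∈ J then x i else z i

lemma measurable_glue (J : Finset (Fin M)) :
    Measurable (fun p : (∀ i, Ω i) × (∀ i, Ω i) => glue J p.1 p.2) := by
  refine measurable_pi_lambda _ fun i => ?_
  by_cases h : i ∈ J
  · simp only [glue, h, if_true]; fun_prop
  · simp only [glue, h, if_false]; fun_prop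

variable (μ : ∀ i, Measure (Ω i)) [∀ i, IsProbabilityMeasure (μ i)]

lemma mp_glue (J : Finset (Fin M)) :
    MeasurePreserving (fun p : (∀ i, Ω i) × (∀ i, Ω i) => glue J p.1 p.2)
      ((Measure.pi μ).prod (Measure.pi μ)) (Measure.pi μ) where
  measurable := measurable_glue J
  map_eq := by
    refine (Measure.pi_eq fun s hs => ?_).symm
    rw [Measure.map_apply (measurable_glue J) (MeasurableSet.univ_pi hs)]
    have : (fun p : (∀ i, Ω i) × (∀ i, Ω i) => glue J p.1 p.2) ⁻¹' (Set.univ.pi s)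
        = (Set.univ.pi fun i => if i ∈ J then s i else Set.univ) ×ˢ
          (Set.univ.pi fun i => if i ∈ J then Set.univ else s i) := by
      ext p
      simp only [glue, Set.mem_preimage, Set.mem_pi, Set.mem_prod, Set.mem_univ, true_imp_iff,
        ← forall_and]
      refine forall_congr' fun i => ?_
      by_cases h : i ∈ J <;> simp [h]
    rw [this, Measure.prod_prod, Measure.pi_pi, Measure.pi_pi, ← Finset.prod_mul_distrib]
    refine Finset.prod_congr rfl fun i _ => ?_
    by_cases h : i ∈ J <;> simp [h]

lemma mp_glue1 (J : Finset (Fin M)) :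
    MeasurePreserving (fun p : (∀ i, Ω i) × ((∀ i, Ω i) × (∀ i, Ω i)) => glue J p.1 p.2.1)
      ((Measure.pi μ).prod ((Measure.pi μ).prod (Measure.pi μ))) (Measure.pi μ) :=
  (mp_glue μ J).comp ((MeasurePreserving.id _).prod measurePreserving_fst)

lemma mp_glue2 (J : Finset (Fin M)) :
    MeasurePreserving (fun p : (∀ i, Ω i) × ((∀ i, Ω i) × (∀ i, Ω i)) => glue J p.1 p.2.2)
      ((Measure.pi μ).prod ((Measure.pi μ).prod (Measure.pi μ))) (Measure.pi μ) :=
  (mp_glue μ J).comp ((MeasurePreserving.id _).prod measurePreserving_snd)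

variable {Y : (∀ i, Ω i) → ℝ} (hY : MemLp Y 2 (Measure.pi μ))

lemma integrable_FF (hY : MemLp Y 2 (Measure.pi μ)) (J K : Finset (Fin M)) :
    Integrable (fun p : (∀ i, Ω i) × ((∀ i, Ω i) × (∀ i, Ω i)) =>
      Y (glue J p.1 p.2.1) * Y (glue K p.1 p.2.2))
      ((Measure.pi μ).prod ((Measure.pi μ).prod (Measure.pi μ))) :=
  (hY.comp_measurePreserving (mp_glue1 μ J)).integrable_mul
    (hY.comp_measurePreserving (mp_glue2 μ K))

lemma margA_mul (J K : Finset (Fin M)) (x : ∀ i, Ω i) :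
    margA μ J Y x * margA μ K Y x =
      ∫ q, Y (glue J x q.1) * Y (glue K x q.2) ∂((Measure.pi μ).prod (Measure.pi μ)) :=
  (integral_prod_mul (fun z => Y (glue J x z)) (fun w => Y (glue K x w))).symm

lemma memLp_margA (hY : MemLp Y 2 (Measure.pi μ)) (J : Finset (Fin M)) :
    MemLp (margA μ J Y) 2 (Measure.pi μ) := by
  have h1 : Integrable (margA μ J Y) (Measure.pi μ) :=
    ((hY.comp_measurePreserving (mp_glue μ J)).integrable one_le_two).integral_prod_left
  rw [memLp_two_iff_integrable_sq h1.aestronglyMeasurable]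
  have := (integrable_FF μ hY J J).integral_prod_left
  refine this.congr (Filter.Eventually.of_forall fun x => ?_)
  simp only [sq, margA_mul]

lemma integral_margA_mul (hY : MemLp Y 2 (Measure.pi μ)) (J K : Finset (Fin M)) :
    ∫ x, margA μ J Y x * margA μ K Y x ∂(Measure.pi μ) =
      ∫ p : (∀ i, Ω i) × ((∀ i, Ω i) × (∀ i, Ω i)), Y (glue J p.1 p.2.1) * Y (glue K p.1 p.2.2)
        ∂((Measure.pi μ).prod ((Measure.pi μ).prod (Measure.pi μ))) := by
  rw [integral_prod _ (integrable_FF μ hY J K)]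
  simp only [margA_mul]

/-- Coordinatewise relabelling of the triple. -/
def tau (J K : Finset (Fin M)) (i : Fin M) (p : Ω i × Ω i × Ω i) : Ω i × Ω i × Ω i :=
  if i ∈ J then (if i ∈ K then p else (p.2.1, p.1, p.2.2))
  else (if i ∈ K then (p.2.2, p.2.1, p.1) else p)

lemma mp_swap12 {α : Type*} [MeasurableSpace α] (m : Measure α) [IsProbabilityMeasure m] :
    MeasurePreserving (fun p : α × α × α => (p.2.1, p.1, p.2.2))
      (m.prod (m.prod m)) (m.prod (m.prod m)) where
  measurable := by fun_prop
  map_eq := by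
    refine Measure.ext_prod₃ fun {s t u} hs ht hu => ?_
    rw [Measure.map_apply (by fun_prop) (hs.prod (ht.prod hu))]
    have : (fun p : α × α × α => (p.2.1, p.1, p.2.2)) ⁻¹' (s ×ˢ t ×ˢ u) = t ×ˢ s ×ˢ u := by
      ext p; simp; tauto
    rw [this]; simp only [Measure.prod_prod]; ring

lemma mp_swap13 {α : Type*} [MeasurableSpace α] (m : Measure α) [IsProbabilityMeasure m] :
    MeasurePreserving (fun p : α × α × α => (p.2.2, p.2.1, p.1))
      (m.prod (m.prod m)) (m.prod (m.prod m)) where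
  measurable := by fun_prop
  map_eq := by
    refine Measure.ext_prod₃ fun {s t u} hs ht hu => ?_
    rw [Measure.map_apply (by fun_prop) (hs.prod (ht.prod hu))]
    have : (fun p : α × α × α => (p.2.2, p.2.1, p.1)) ⁻¹' (s ×ˢ t ×ˢ u) = u ×ˢ t ×ˢ s := by
      ext p; simp; tauto
    rw [this]; simp only [Measure.prod_prod]; ring

lemma mp_tau (J K : Finset (Fin M)) (i : Fin M) :
    MeasurePreserving (tau (Ω := Ω) J K i)
      ((μ i).prod ((μ i).prod (μ i))) ((μ i).prod ((μ i).prod (μ i))) := by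
  unfold tau
  by_cases hJ : i ∈ J <;> by_cases hK : i ∈ K <;> simp only [hJ, hK, if_true, if_false]
  · exact MeasurePreserving.id _
  · exact mp_swap12 _
  · exact mp_swap13 _
  · exact MeasurePreserving.id _

lemma mp_triple :
    MeasurePreserving (fun a : (∀ i, Ω i × Ω i × Ω i) =>
      ((fun i => (a i).1), ((fun i => (a i).2.1), (fun i => (a i).2.2))))
      (Measure.pi (fun i => (μ i).prod ((μ i).prod (μ i))))
      ((Measure.pi μ).prod ((Measure.pi μ).prod (Measure.pi μ))) :=
  ((MeasurePreserving.id _).prod (mp_pi_prod μ μ)).comp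
    (mp_pi_prod μ (fun i => (μ i).prod (μ i)))

lemma integral_comp_mp {α β : Type*} [MeasurableSpace α] [MeasurableSpace β] {m : Measure α}
    {n : Measure β} {f : α → β} (hf : MeasurePreserving f m n) {g : β → ℝ} (hg : Integrable g n) :
    ∫ y, g y ∂n = ∫ x, g (f x) ∂m := by
  rw [← hf.map_eq]
  refine integral_map hf.measurable.aemeasurable ?_
  rw [hf.map_eq]; exact hg.aestronglyMeasurable

lemma integral_margA_mul_inter (hY : MemLp Y 2 (Measure.pi μ)) (J K : Finset (Fin M)) :
    ∫ x, margA μ J Y x * margA μ K Y x ∂(Measure.pi μ) =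
      ∫ x, margA μ (J ∩ K) Y x * margA μ (J ∩ K) Y x ∂(Measure.pi μ) := by
  rw [integral_margA_mul μ hY, integral_margA_mul μ hY,
    integral_comp_mp ((mp_triple μ).comp
      (measurePreserving_pi _ _ (mp_tau μ J K))) (integrable_FF μ hY J K),
    integral_comp_mp (mp_triple μ) (integrable_FF μ hY (J ∩ K) (J ∩ K))]
  refine integral_congr_ae (Filter.Eventually.of_forall fun a => ?_)
  have h1 : ∀ i, (if i ∈ J then (tau J K i (a i)).1 else (tau J K i (a i)).2.1) =
      if i ∈ J ∩ K then (a i).1 else (a i).2.1 := by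
    intro i
    by_cases hJ : i ∈ J <;> by_cases hK : i ∈ K <;> simp [tau, hJ, hK]
  have h2 : ∀ i, (if i ∈ K then (tau J K i (a i)).1 else (tau J K i (a i)).2.2) =
      if i ∈ J ∩ K then (a i).1 else (a i).2.2 := by
    intro i
    by_cases hJ : i ∈ J <;> by_cases hK : i ∈ K <;> simp [tau, hJ, hK]
  exact congrArg₂ (fun u v => Y u * Y v) (funext h1) (funext h2)

lemma anovaP_eq (Y : (∀ i, Ω i) → ℝ) (I : Finset (Fin M)) :
    anovaP μ Y I = margA μ I Y - ∑ J ∈ I.ssubsets, anovaP μ Y J := by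
  rw [anovaP, Finset.sum_attach I.ssubsets (fun J => anovaP μ Y J)]

lemma sum_anovaP (Y : (∀ i, Ω i) → ℝ) (I : Finset (Fin M)) :
    ∑ J ∈ I.powerset, anovaP μ Y J = margA μ I Y := by
  rw [← Finset.sum_erase_add _ _ (Finset.mem_powerset_self I)]
  rw [anovaP_eq μ Y I]
  simp [Finset.ssubsets]

lemma memLp_anovaP (hY : MemLp Y 2 (Measure.pi μ)) (I : Finset (Fin M)) :
    MemLp (anovaP μ Y I) 2 (Measure.pi μ) := by
  induction I using Finset.strongInduction with
  | H I ih =>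
    rw [anovaP_eq]
    exact (memLp_margA μ hY I).sub
      (memLp_finsetSum' _ fun J hJ => ih J (Finset.mem_ssubsets.mp hJ))

lemma integral_sum_mul {s : Finset (Finset (Fin M))} {f : Finset (Fin M) → (∀ i, Ω i) → ℝ}
    {g : (∀ i, Ω i) → ℝ} (hf : ∀ J, MemLp (f J) 2 (Measure.pi μ))
    (hg : MemLp g 2 (Measure.pi μ)) :
    ∫ x, (∑ J ∈ s, f J) x * g x ∂(Measure.pi μ) = ∑ J ∈ s, ∫ x, f J x * g x ∂(Measure.pi μ) := by
  rw [← integral_finsetSum s (f := fun J x => f J x * g x)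
    fun J _ => (hf J).integrable_mul hg]
  simp [Finset.sum_mul]

lemma anovaP_mul_margA (hY : MemLp Y 2 (Measure.pi μ)) (K I : Finset (Fin M)) (h : ¬ I ⊆ K) :
    ∫ x, anovaP μ Y I x * margA μ K Y x ∂(Measure.pi μ) = 0 := by
  induction I using Finset.strongInduction with
  | H I ih =>
    have hP := memLp_anovaP μ hY
    have hK := memLp_margA μ hY K
    have e1 : ∫ x, (∑ J ∈ I.powerset, anovaP μ Y J) x * margA μ K Y x ∂(Measure.pi μ)
        = ∫ x, (∑ J ∈ (I ∩ K).powerset, anovaP μ Y J) x * margA μ K Y x ∂(Measure.pi μ) := by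
      rw [sum_anovaP, sum_anovaP, integral_margA_mul_inter μ hY I K,
        integral_margA_mul_inter μ hY (I ∩ K) K]
      simp [Finset.inter_assoc]
    rw [integral_sum_mul μ hP hK, integral_sum_mul μ hP hK,
      ← Finset.sum_erase_add _ _ (Finset.mem_powerset_self I)] at e1
    have e2 : ∑ J ∈ (I ∩ K).powerset, ∫ x, anovaP μ Y J x * margA μ K Y x ∂(Measure.pi μ)
        = ∑ J ∈ I.powerset.erase I, ∫ x, anovaP μ Y J x * margA μ K Y x ∂(Measure.pi μ) := by
      refine Finset.sum_subset ?_ ?_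
      · intro J hJ
        rw [Finset.mem_powerset, Finset.subset_inter_iff] at hJ
        rw [Finset.mem_erase, Finset.mem_powerset]
        exact ⟨fun hh => h (hh ▸ hJ.2), hJ.1⟩
      · intro J hJ hJ'
        rw [Finset.mem_erase, Finset.mem_powerset] at hJ
        rw [Finset.mem_powerset, Finset.subset_inter_iff] at hJ'
        exact ih J (Finset.ssubset_iff_subset_ne.mpr ⟨hJ.2, hJ.1⟩) fun hh => hJ' ⟨hJ.2, hh⟩
    linarith

lemma anovaP_mul_anovaP_aux (hY : MemLp Y 2 (Measure.pi μ)) (I K : Finset (Fin M))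
    (h : ¬ I ⊆ K) : ∫ x, anovaP μ Y K x * anovaP μ Y I x ∂(Measure.pi μ) = 0 := by
  induction K using Finset.strongInduction with
  | H K ih =>
    have hP := memLp_anovaP μ hY
    have e := anovaP_mul_margA μ hY K I h
    simp only [mul_comm (anovaP μ Y I _)] at e
    rw [← sum_anovaP, integral_sum_mul μ hP (hP I),
      ← Finset.sum_erase_add _ _ (Finset.mem_powerset_self K),
      Finset.sum_eq_zero, zero_add] at e
    · exact e
    · intro J hJ
      rw [Finset.mem_erase, Finset.mem_powerset] at hJ
      exact ih J (Finset.ssubset_iff_subset_ne.mpr ⟨hJ.2, hJ.1⟩) fun hh => h (hh.trans hJ.2)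

lemma anovaP_mul_anovaP (hY : MemLp Y 2 (Measure.pi μ)) (I K : Finset (Fin M))
    (h : I ≠ K) : ∫ x, anovaP μ Y K x * anovaP μ Y I x ∂(Measure.pi μ) = 0 := by
  by_cases h1 : I ⊆ K
  · have h2 : ¬ K ⊆ I := fun h2 => h (h1.antisymm h2)
    simpa only [mul_comm] using anovaP_mul_anovaP_aux μ hY K I h2
  · exact anovaP_mul_anovaP_aux μ hY I K h1

lemma integral_sq_eq_sum (hY : MemLp Y 2 (Measure.pi μ)) :
    ∫ x, Y x ^ 2 ∂(Measure.pi μ) = ∑ I ∈ (Finset.univ : Finset (Fin M)).powerset,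
      ∫ x, anovaP μ Y I x ^ 2 ∂(Measure.pi μ) := by
  have hP := memLp_anovaP μ hY
  have hA : margA μ Finset.univ Y = Y := by
    ext x; simp [margA]
  have hS : Y = ∑ I ∈ (Finset.univ : Finset (Fin M)).powerset, anovaP μ Y I := by
    rw [sum_anovaP, hA]
  have e : ∫ x, Y x ^ 2 ∂(Measure.pi μ) =
      ∫ x, (∑ I ∈ (Finset.univ : Finset (Fin M)).powerset, anovaP μ Y I) x * Y x
        ∂(Measure.pi μ) := by
    rw [← hS]; simp only [sq]
  rw [e, integral_sum_mul μ hP hY]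
  refine Finset.sum_congr rfl fun I hI => ?_
  have e2 : ∫ x, anovaP μ Y I x * Y x ∂(Measure.pi μ) =
      ∫ x, (∑ K ∈ (Finset.univ : Finset (Fin M)).powerset, anovaP μ Y K) x * anovaP μ Y I x
        ∂(Measure.pi μ) := by
    rw [← hS]; simp only [mul_comm]
  rw [e2, integral_sum_mul μ hP (hP I), Finset.sum_eq_single_of_mem I hI]
  · simp only [sq]
  · intro K _ hK
    exact anovaP_mul_anovaP μ hY I K hK.symm

end AnovaHelpers

/-- **ANOVA variance decomposition.** If `Y` is square-integrable w.r.t. the product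
probability measure, then `Var(Y) = ∑_{∅ ≠ I ⊆ N} σ²_I(Y)` with
`σ²_I(Y) = ∫ (P_I Y)² dμ`; equivalently, with the convention `σ²_∅(Y) = 0`,
`σ²(Y) = ∑_{I ⊆ N} σ²_I(Y)`. -/
theorem variance_eq_sum_anova
    {M : ℕ} (hM : 1 ≤ M) {Ω : Fin M → Type*} [∀ i, MeasurableSpace (Ω i)]
    (μ : ∀ i, Measure (Ω i)) [∀ i, IsProbabilityMeasure (μ i)]
    (Y : (∀ i, Ω i) → ℝ) (hY : MemLp Y 2 (Measure.pi μ)) :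
    variance Y (Measure.pi μ)
      = ∑ I ∈ (Finset.univ : Finset (Fin M)).powerset.erase ∅,
          ∫ x, (anovaP μ Y I x) ^ 2 ∂(Measure.pi μ)
    ∧ variance Y (Measure.pi μ)
      = ∑ I ∈ (Finset.univ : Finset (Fin M)).powerset,
          (if I = ∅ then 0 else ∫ x, (anovaP μ Y I x) ^ 2 ∂(Measure.pi μ)) := by
  have hmain : variance Y (Measure.pi μ)
      = ∑ I ∈ (Finset.univ : Finset (Fin M)).powerset.erase ∅,
          ∫ x, (anovaP μ Y I x) ^ 2 ∂(Measure.pi μ) := by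
    have h0 : anovaP μ Y ∅ = fun _ => ∫ z, Y z ∂(Measure.pi μ) := by
      rw [anovaP_eq]
      ext x
      simp [margA, Finset.ssubsets]
    rw [variance_eq_sub hY]
    have h := integral_sq_eq_sum μ hY
    rw [← Finset.sum_erase_add _ _ (Finset.empty_mem_powerset _), h0] at h
    simp only [Pi.pow_apply, h]
    simp
  refine ⟨hmain, ?_⟩
  rw [hmain, ← Finset.sum_erase_add _ _ (Finset.empty_mem_powerset (Finset.univ : Finset (Fin M)))]
  simp only [if_true, add_zero]
  refine Finset.sum_congr rfl fun I hI => ?_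
  rw [if_neg (Finset.ne_of_mem_erase hI)]
end

section
/- Let S = Σ_{α∈A} c_α Φ_α be a PCE surrogate built from tensor-product orthonormal basis functions with φ^i_0 ≡ 1, and suppose Σ_{α∈A, α≠0} c_α² > 0. Then for every nonempty I ⊆ N the Sobol' index of S equals S_I[S] = (Σ_{α∈A, supp(α)=I} c_α²) / (Σ_{α∈A, α≠0} c_α²), and for every i ∈ N the total sensitivity index equals S_i^T[S] = (Σ_{α∈A, α_i>0} c_α²) / (Σ_{α∈A, α≠0} c_α²). -/
open MeasureTheory

open ProbabilityTheory

lemma pce_integrable {M No : ℕ} {Ω : Fin M → Type*} [∀ i, MeasurableSpace (Ω i)]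
    (μ : ∀ i, Measure (Ω i)) [∀ i, IsProbabilityMeasure (μ i)]
    (φ : ∀ i : Fin M, Fin (No + 1) → Ω i → ℝ)
    (hφ2 : ∀ i p, MemLp (φ i p) 2 (μ i)) (α : Fin M → Fin (No + 1)) :
    Integrable (fun x : ∀ i, Ω i => ∏ i, φ i (α i) (x i)) (Measure.pi μ) :=
  Integrable.fintype_prod_dep (f := fun i => φ i (α i))
    (fun i => (hφ2 i (α i)).integrable (by norm_num))

lemma pce_integrable_mul {M No : ℕ} {Ω : Fin M → Type*} [∀ i, MeasurableSpace (Ω i)]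
    (μ : ∀ i, Measure (Ω i)) [∀ i, IsProbabilityMeasure (μ i)]
    (φ : ∀ i : Fin M, Fin (No + 1) → Ω i → ℝ)
    (hφ2 : ∀ i p, MemLp (φ i p) 2 (μ i)) (α β : Fin M → Fin (No + 1)) :
    Integrable (fun x : ∀ i, Ω i => (∏ i, φ i (α i) (x i)) * ∏ i, φ i (β i) (x i))
      (Measure.pi μ) := by
  simp_rw [← Finset.prod_mul_distrib]
  exact Integrable.fintype_prod_dep (f := fun i t => φ i (α i) t * φ i (β i) t)
    (fun i => (hφ2 i (α i)).integrable_mul (hφ2 i (β i)))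

lemma pce_orth {M No : ℕ} {Ω : Fin M → Type*} [∀ i, MeasurableSpace (Ω i)]
    (μ : ∀ i, Measure (Ω i)) [∀ i, IsProbabilityMeasure (μ i)]
    (φ : ∀ i : Fin M, Fin (No + 1) → Ω i → ℝ)
    (horth : ∀ i p q, ∫ t, φ i p t * φ i q t ∂(μ i) = if p = q then 1 else 0)
    (α β : Fin M → Fin (No + 1)) :
    ∫ x : ∀ i, Ω i, (∏ i, φ i (α i) (x i)) * ∏ i, φ i (β i) (x i) ∂(Measure.pi μ)
      = if α = β then 1 else 0 := by
  simp_rw [← Finset.prod_mul_distrib]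
  rw [integral_fintype_prod_eq_prod (f := fun i t => φ i (α i) t * φ i (β i) t)]
  simp_rw [horth]
  split_ifs with h
  · simp [h]
  · obtain ⟨i, hi⟩ := Function.ne_iff.mp h
    exact Finset.prod_eq_zero (Finset.mem_univ i) (by simp [hi])

lemma pce_sq {M No : ℕ} {Ω : Fin M → Type*} [∀ i, MeasurableSpace (Ω i)]
    (μ : ∀ i, Measure (Ω i)) [∀ i, IsProbabilityMeasure (μ i)]
    (φ : ∀ i : Fin M, Fin (No + 1) → Ω i → ℝ)
    (hφ2 : ∀ i p, MemLp (φ i p) 2 (μ i))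
    (horth : ∀ i p q, ∫ t, φ i p t * φ i q t ∂(μ i) = if p = q then 1 else 0)
    (B : Finset (Fin M → Fin (No + 1))) (c : (Fin M → Fin (No + 1)) → ℝ) :
    ∫ x : ∀ i, Ω i, (∑ α ∈ B, c α * ∏ i, φ i (α i) (x i)) ^ 2 ∂(Measure.pi μ)
      = ∑ α ∈ B, c α ^ 2 := by
  have h1 : ∀ x : ∀ i, Ω i, (∑ α ∈ B, c α * ∏ i, φ i (α i) (x i)) ^ 2
      = ∑ α ∈ B, ∑ β ∈ B, (c α * c β) *
        ((∏ i, φ i (α i) (x i)) * ∏ i, φ i (β i) (x i)) := by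
    intro x
    rw [sq, Finset.sum_mul_sum]
    refine Finset.sum_congr rfl fun α _ => Finset.sum_congr rfl fun β _ => by ring
  simp_rw [h1]
  have h2 : ∀ α β, Integrable (fun x : ∀ i, Ω i => (c α * c β) *
        ((∏ i, φ i (α i) (x i)) * ∏ i, φ i (β i) (x i))) (Measure.pi μ) :=
    fun α β => (pce_integrable_mul μ φ hφ2 α β).const_mul _
  rw [integral_finsetSum _ (fun α _ => integrable_finsetSum _ fun β _ => h2 α β)]
  refine Finset.sum_congr rfl fun α hα => ?_
  rw [integral_finsetSum _ (fun β _ => h2 α β)]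
  simp_rw [integral_const_mul, pce_orth μ φ horth]
  simp [hα, sq]

lemma pce_marg {M No : ℕ} {Ω : Fin M → Type*} [∀ i, MeasurableSpace (Ω i)]
    (μ : ∀ i, Measure (Ω i)) [∀ i, IsProbabilityMeasure (μ i)]
    (φ : ∀ i : Fin M, Fin (No + 1) → Ω i → ℝ)
    (hφ2 : ∀ i p, MemLp (φ i p) 2 (μ i))
    (horth : ∀ i p q, ∫ t, φ i p t * φ i q t ∂(μ i) = if p = q then 1 else 0)
    (hφ0 : ∀ i, φ i 0 = fun _ => (1 : ℝ))
    (A : Finset (Fin M → Fin (No + 1))) (c : (Fin M → Fin (No + 1)) → ℝ)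
    (J : Finset (Fin M)) (x : ∀ i, Ω i) :
    margA μ J (fun x => ∑ α ∈ A, c α * ∏ i, φ i (α i) (x i)) x
      = ∑ α ∈ A.filter (fun α => Finset.univ.filter (fun i => α i ≠ 0) ⊆ J),
          c α * ∏ i, φ i (α i) (x i) := by
  have hmean : ∀ i p, ∫ t, φ i p t ∂(μ i) = if p = 0 then 1 else 0 := by
    intro i p
    rw [← horth i p 0]
    simp [hφ0]
  let g : (Fin M → Fin (No + 1)) → ∀ i, Ω i → ℝ := fun α i t =>
    if i ∈ J then φ i (α i) (x i) else φ i (α i) t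
  have hg : ∀ α (z : ∀ i, Ω i), ∏ i, φ i (α i) (if i ∈ J then x i else z i)
      = ∏ i, g α i (z i) := by
    intro α z
    refine Finset.prod_congr rfl fun i _ => ?_
    by_cases h : i ∈ J <;> simp [g, h]
  have hint : ∀ α, Integrable (fun z : ∀ i, Ω i => ∏ i, g α i (z i)) (Measure.pi μ) := by
    intro α
    refine Integrable.fintype_prod_dep (f := g α) fun i => ?_
    by_cases h : i ∈ J
    · simp [g, h]
    · simpa [g, h] using (hφ2 i (α i)).integrable (by norm_num)
  unfold margA
  simp_rw [hg]
  rw [integral_finsetSum _ (fun α _ => (hint α).const_mul _), Finset.sum_filter]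
  refine Finset.sum_congr rfl fun α _ => ?_
  rw [integral_const_mul, integral_fintype_prod_eq_prod (f := g α)]
  have hgi : ∀ i, ∫ t, g α i t ∂(μ i)
      = if i ∈ J then φ i (α i) (x i) else if α i = 0 then 1 else 0 := by
    intro i
    by_cases h : i ∈ J
    · simp [g, h]
    · simp [g, h, hmean]
  simp_rw [hgi]
  split_ifs with h
  · congr 1
    refine Finset.prod_congr rfl fun i _ => ?_
    by_cases hi : i ∈ J
    · simp [hi]
    · have h0 : α i = 0 := by
        by_contra h0
        exact hi (h (by simp [h0]))
      simp [hi, h0, hφ0]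
  · obtain ⟨i, hi, hiJ⟩ := Finset.not_subset.mp h
    rw [Finset.prod_eq_zero (Finset.mem_univ i), mul_zero]
    simp at hi
    simp [hiJ, hi]

lemma pce_anova {M No : ℕ} {Ω : Fin M → Type*} [∀ i, MeasurableSpace (Ω i)]
    (μ : ∀ i, Measure (Ω i)) [∀ i, IsProbabilityMeasure (μ i)]
    (φ : ∀ i : Fin M, Fin (No + 1) → Ω i → ℝ)
    (hφ2 : ∀ i p, MemLp (φ i p) 2 (μ i))
    (horth : ∀ i p q, ∫ t, φ i p t * φ i q t ∂(μ i) = if p = q then 1 else 0)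
    (hφ0 : ∀ i, φ i 0 = fun _ => (1 : ℝ))
    (A : Finset (Fin M → Fin (No + 1))) (c : (Fin M → Fin (No + 1)) → ℝ)
    (x : ∀ i, Ω i) (I : Finset (Fin M)) :
    anovaP μ (fun x => ∑ α ∈ A, c α * ∏ i, φ i (α i) (x i)) I x
      = ∑ α ∈ A.filter (fun α => Finset.univ.filter (fun i => α i ≠ 0) = I),
          c α * ∏ i, φ i (α i) (x i) := by
  induction I using Finset.strongInduction with
  | H I ih =>
    rw [anovaP, Pi.sub_apply, Finset.sum_apply, pce_marg μ φ hφ2 horth hφ0]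
    rw [Finset.sum_attach I.ssubsets
      (fun J => anovaP μ (fun x => ∑ α ∈ A, c α * ∏ i, φ i (α i) (x i)) J x)]
    rw [Finset.sum_congr rfl (fun J hJ => ih J (Finset.mem_ssubsets.mp hJ))]
    simp_rw [Finset.sum_filter]
    rw [Finset.sum_comm, ← Finset.sum_sub_distrib]
    refine Finset.sum_congr rfl fun α _ => ?_
    rw [Finset.sum_ite_eq]
    simp only [Finset.mem_ssubsets]
    generalize Finset.univ.filter (fun i => α i ≠ 0) = s
    by_cases h1 : s = I
    · subst h1
      simp
    · by_cases h2 : s ⊆ I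
      · simp [h1, h2, Finset.ssubset_iff_subset_ne]
      · simp [h1, h2, Finset.ssubset_iff_subset_ne]

lemma pce_variance {M No : ℕ} {Ω : Fin M → Type*} [∀ i, MeasurableSpace (Ω i)]
    (μ : ∀ i, Measure (Ω i)) [∀ i, IsProbabilityMeasure (μ i)]
    (φ : ∀ i : Fin M, Fin (No + 1) → Ω i → ℝ)
    (hφ2 : ∀ i p, MemLp (φ i p) 2 (μ i))
    (horth : ∀ i p q, ∫ t, φ i p t * φ i q t ∂(μ i) = if p = q then 1 else 0)
    (hφ0 : ∀ i, φ i 0 = fun _ => (1 : ℝ))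
    (A : Finset (Fin M → Fin (No + 1))) (c : (Fin M → Fin (No + 1)) → ℝ) :
    variance (fun x => ∑ α ∈ A, c α * ∏ i, φ i (α i) (x i)) (Measure.pi μ)
      = ∑ α ∈ A.filter (fun α => α ≠ 0), c α ^ 2 := by
  have hI : Integrable (fun x : ∀ i, Ω i => ∑ α ∈ A, c α * ∏ i, φ i (α i) (x i))
      (Measure.pi μ) :=
    integrable_finsetSum _ fun α _ => (pce_integrable μ φ hφ2 α).const_mul _
  rw [variance_eq_integral hI.aemeasurable, ← pce_sq μ φ hφ2 horth]
  refine integral_congr_ae (Filter.Eventually.of_forall fun x => ?_)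
  have hm := pce_marg μ φ hφ2 horth hφ0 A c ∅ x
  simp only [margA, Finset.notMem_empty, if_false] at hm
  simp only
  rw [hm]
  congr 1
  simp_rw [Finset.sum_filter]
  rw [← Finset.sum_sub_distrib]
  refine Finset.sum_congr rfl fun α _ => ?_
  by_cases h : α = 0
  · simp [h]
  · have h' : ¬ (Finset.univ.filter (fun i => α i ≠ 0) ⊆ ∅) := by
      obtain ⟨i, hi⟩ := Function.ne_iff.mp h
      intro hs
      exact absurd (hs (by simpa using hi : i ∈ _)) (Finset.notMem_empty i)
    rw [if_neg h', if_pos h, sub_zero]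

/-- **Sobol' indices of a PCE surrogate from its coefficients.** For a PCE
surrogate `S = ∑_{α∈A} c_α Φ_α` built from tensor-product orthonormal basis
functions with `φ^i_0 ≡ 1`, and assuming `∑_{α≠0} c_α² > 0`, the Sobol' index of
every nonempty `I ⊆ N` equals `(∑_{supp(α)=I} c_α²)/(∑_{α≠0} c_α²)` and the
total sensitivity index of every `i ∈ N` equals
`(∑_{α_i>0} c_α²)/(∑_{α≠0} c_α²)`. -/
theorem sobol_indices_pce_surrogate
    {M No : ℕ} (hM : 1 ≤ M) {Ω : Fin M → Type*} [∀ i, MeasurableSpace (Ω i)]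
    (μ : ∀ i, Measure (Ω i)) [∀ i, IsProbabilityMeasure (μ i)]
    (φ : ∀ i : Fin M, Fin (No + 1) → Ω i → ℝ)
    (hφ2 : ∀ i p, MemLp (φ i p) 2 (μ i))
    (horth : ∀ i p q, ∫ t, φ i p t * φ i q t ∂(μ i) = if p = q then 1 else 0)
    (hφ0 : ∀ i, φ i 0 = fun _ => (1 : ℝ))
    (A : Finset (Fin M → Fin (No + 1))) (c : (Fin M → Fin (No + 1)) → ℝ)
    (hc : 0 < ∑ α ∈ A.filter (fun α => α ≠ 0), c α ^ 2) :
    (∀ I : Finset (Fin M), I ≠ ∅ →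
        (∫ x, (anovaP μ (fun x => ∑ α ∈ A, c α * ∏ i, φ i (α i) (x i)) I x) ^ 2
            ∂(Measure.pi μ))
          / variance (fun x => ∑ α ∈ A, c α * ∏ i, φ i (α i) (x i)) (Measure.pi μ)
        = (∑ α ∈ A.filter (fun α => Finset.univ.filter (fun i => α i ≠ 0) = I), c α ^ 2)
          / ∑ α ∈ A.filter (fun α => α ≠ 0), c α ^ 2)
    ∧ (∀ i : Fin M,
        (∑ I ∈ (Finset.univ : Finset (Fin M)).powerset.filter (fun I => i ∈ I),
          (∫ x, (anovaP μ (fun x => ∑ α ∈ A, c α * ∏ i, φ i (α i) (x i)) I x) ^ 2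
              ∂(Measure.pi μ))
            / variance (fun x => ∑ α ∈ A, c α * ∏ i, φ i (α i) (x i)) (Measure.pi μ))
        = (∑ α ∈ A.filter (fun α => α i ≠ 0), c α ^ 2)
          / ∑ α ∈ A.filter (fun α => α ≠ 0), c α ^ 2) := by
  have key : ∀ I : Finset (Fin M),
      (∫ x, (anovaP μ (fun x => ∑ α ∈ A, c α * ∏ i, φ i (α i) (x i)) I x) ^ 2
            ∂(Measure.pi μ))
          / variance (fun x => ∑ α ∈ A, c α * ∏ i, φ i (α i) (x i)) (Measure.pi μ)
        = (∑ α ∈ A.filter (fun α => Finset.univ.filter (fun i => α i ≠ 0) = I), c α ^ 2)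
          / ∑ α ∈ A.filter (fun α => α ≠ 0), c α ^ 2 := by
    intro I
    rw [pce_variance μ φ hφ2 horth hφ0]
    simp_rw [pce_anova μ φ hφ2 horth hφ0]
    rw [pce_sq μ φ hφ2 horth]
  refine ⟨fun I _ => key I, fun i => ?_⟩
  rw [Finset.sum_congr rfl (fun I _ => key I), ← Finset.sum_div]
  congr 1
  simp_rw [Finset.sum_filter (s := A)]
  rw [Finset.sum_comm]
  refine Finset.sum_congr rfl fun α _ => ?_
  rw [Finset.sum_ite_eq]
  simp
end
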